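/- Let 1 ≤ a ≤ b, and let f be a polynomial in the entries of an a×b matrix over ℂ such that f(g·z) = f(z) for every g ∈ SL_a(ℂ) and every a×b complex matrix z. Then f lies in the ℂ-subalgebra generated by the Plücker coordinates P_J, where J ranges over the a-element subsets of the column set {1,…,b}. That is, the Plücker ring R_{a,b} = ℂ[Mat_{a×b}]^{SL_a} is generated by the Plücker coordinates. -/

import Mathlib

open MvPolynomial

/-- The Plücker coordinate `P_J` of the generic `a × b` matrix of indeterminates:
the `a × a` minor occupying the columns in the `a`-element subset `J` of the columns,
taken in increasing order. -/
noncomputable def plucker {a b : ℕ} (J : Finset (Fin b)) (h : J.card = a) :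
    MvPolynomial (Fin a × Fin b) ℂ :=
  Matrix.det (Matrix.of fun r c : Fin a => X (r, J.orderEmbOfFin h c))

open Matrix (mvPolynomialX)

/-- The Fischer pairing `⟨p, q⟩ = ∑ α, α! p_α q_α`, for which multiplication by `X i`
is adjoint to `∂ / ∂ X i`. -/
noncomputable def fischerPairing {σ : Type*} [Fintype σ] :
    MvPolynomial σ ℂ →ₗ[ℂ] MvPolynomial σ ℂ →ₗ[ℂ] ℂ :=
  (basisMonomials σ ℂ).constr ℂ fun α => ((∏ i, (α i).factorial : ℕ) : ℂ) • lcoeff ℂ α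

section FischerPairing

variable {σ : Type*} [Fintype σ]

theorem fischerPairing_monomial (α : σ →₀ ℕ) (c : ℂ) (q : MvPolynomial σ ℂ) :
    fischerPairing (monomial α c) q = c * ((∏ i, (α i).factorial : ℕ) * coeff α q) := by
  have h : fischerPairing (monomial α 1) q = (∏ i, (α i).factorial : ℕ) * coeff α q := by
    have := (basisMonomials σ ℂ).constr_basis ℂ
      (fun α => ((∏ i, (α i).factorial : ℕ) : ℂ) • lcoeff ℂ α) α
    rw [coe_basisMonomials] at this
    rw [fischerPairing, this]
    simp [lcoeff]
  rw [← h, ← smul_eq_mul, ← LinearMap.smul_apply, ← map_smul, smul_monomial, smul_eq_mul, mul_one]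

theorem fischerPairing_apply (p q : MvPolynomial σ ℂ) :
    fischerPairing p q =
      ∑ α ∈ p.support, coeff α p * ((∏ i, (α i).factorial : ℕ) * coeff α q) := by
  conv_lhs => rw [p.as_sum]
  simp only [map_sum, LinearMap.sum_apply, fischerPairing_monomial]

theorem fischerPairing_one (q : MvPolynomial σ ℂ) : fischerPairing 1 q = coeff 0 q := by
  rw [← C_1, ← monomial_zero', fischerPairing_monomial]
  simp

theorem fischerPairing_X_mul (i : σ) (p q : MvPolynomial σ ℂ) :
    fischerPairing (X i * p) q = fischerPairing p (pderiv i q) := by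
  classical
  induction p using MvPolynomial.induction_on' with
  | add p₁ p₂ h₁ h₂ => simp only [mul_add, map_add, LinearMap.add_apply, h₁, h₂]
  | monomial α c =>
    have hfac : (∏ j, ((Finsupp.single i 1 + α : σ →₀ ℕ) j).factorial)
        = (α i + 1) * ∏ j, (α j).factorial := by
      rw [← Finset.mul_prod_erase _ _ (Finset.mem_univ i),
        ← Finset.mul_prod_erase _ (fun j => (α j).factorial) (Finset.mem_univ i), ← mul_assoc]
      congr 1
      · simp [add_comm 1, Nat.factorial_succ]
      · refine Finset.prod_congr rfl fun j hj => ?_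
        simp [(Finset.ne_of_mem_erase hj).symm]
    rw [X, monomial_mul, one_mul, fischerPairing_monomial, fischerPairing_monomial,
      coeff_pderiv, hfac, add_comm α]
    push_cast
    ring

theorem fischerPairing_eq_zero_of_isHomogeneous {p q : MvPolynomial σ ℂ} {m n : ℕ}
    (hp : p.IsHomogeneous m) (hq : q.IsHomogeneous n) (hmn : m ≠ n) :
    fischerPairing p q = 0 := by
  rw [fischerPairing_apply]
  refine Finset.sum_eq_zero fun α hα => ?_
  rw [hq.coeff_eq_zero, mul_zero, mul_zero]
  intro h
  refine mem_support_iff.mp hα (hp.coeff_eq_zero ?_)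
  exact fun h' => hmn (h'.symm.trans h)

theorem fischerPairing_map_int_self_ne_zero {p : MvPolynomial σ ℤ} (hp : p ≠ 0) :
    fischerPairing (map (Int.castRingHom ℂ) p) (map (Int.castRingHom ℂ) p) ≠ 0 := by
  have hsum : fischerPairing (map (Int.castRingHom ℂ) p) (map (Int.castRingHom ℂ) p) =
      ((∑ α ∈ p.support, coeff α p * ((∏ i, (α i).factorial : ℕ) * coeff α p) : ℤ) : ℂ) := by
    rw [fischerPairing_apply, support_map_of_injective _ Int.cast_injective]
    simp [coeff_map]
  rw [hsum]
  refine Int.cast_ne_zero.mpr (ne_of_gt (Finset.sum_pos (fun α hα => ?_) ?_))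
  · have h₁ : (0 : ℤ) < (∏ i, (α i).factorial : ℕ) :=
      Int.natCast_pos.mpr (Finset.prod_pos fun i _ => Nat.factorial_pos _)
    have h₂ := mul_self_pos.mpr (mem_support_iff.mp hα)
    nlinarith
  · exact support_nonempty.mpr hp

end FischerPairing

section GenericDet

theorem isHomogeneous_det_mvPolynomialX (n R : Type*) [Fintype n] [DecidableEq n] [CommRing R] :
    (mvPolynomialX n n R).det.IsHomogeneous (Fintype.card n) := by
  rw [Matrix.det_apply]
  refine IsHomogeneous.sum _ _ _ fun τ _ => ?_
  have h : (∏ i, mvPolynomialX n n R (τ i) i).IsHomogeneous (∑ _i : n, 1) :=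
    IsHomogeneous.prod _ _ _ fun i _ => isHomogeneous_X _ _
  rw [Finset.sum_const, smul_eq_mul, mul_one, Finset.card_univ] at h
  rw [Units.smul_def, ← Int.cast_smul_eq_zsmul R]
  exact (homogeneousSubmodule _ _ _).smul_mem _ h

theorem fischerPairing_det_pow_self_ne_zero (n : Type*) [Fintype n] [DecidableEq n] (k : ℕ) :
    fischerPairing ((mvPolynomialX n n ℂ).det ^ k) ((mvPolynomialX n n ℂ).det ^ k) ≠ 0 := by
  have h : (mvPolynomialX n n ℂ).det ^ k =
      map (Int.castRingHom ℂ) ((mvPolynomialX n n ℤ).det ^ k) := by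
    rw [map_pow, RingHom.map_det]
    congr 2
    ext i j : 1
    simp
  rw [h]
  exact fischerPairing_map_int_self_ne_zero (pow_ne_zero _ (Matrix.det_mvPolynomialX_ne_zero n ℤ))

theorem fischerPairing_det_pow_of_ne {n : Type*} [Fintype n] [DecidableEq n] [Nonempty n]
    {j k : ℕ} (hjk : j ≠ k) :
    fischerPairing ((mvPolynomialX n n ℂ).det ^ j) ((mvPolynomialX n n ℂ).det ^ k) = 0 :=
  fischerPairing_eq_zero_of_isHomogeneous
    ((isHomogeneous_det_mvPolynomialX n ℂ).pow j) ((isHomogeneous_det_mvPolynomialX n ℂ).pow k)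
    fun h => hjk (Nat.eq_of_mul_eq_mul_left Fintype.card_pos h)

end GenericDet

section GenericTranslate

variable {m n : Type*} [Fintype m]

/-- The polynomial `g ↦ F (g * z)` in the entries of a generic square matrix `g`. -/
noncomputable def genericTranslate (z : Matrix m n ℂ) :
    MvPolynomial (m × n) ℂ →ₐ[ℂ] MvPolynomial (m × m) ℂ :=
  aeval fun q => ∑ l, C (z l q.2) * X (q.1, l)

theorem eval_genericTranslate (g : Matrix m m ℂ) (z : Matrix m n ℂ) (F : MvPolynomial (m × n) ℂ) :
    eval (fun q => g q.1 q.2) (genericTranslate z F) = eval (fun q => (g * z) q.1 q.2) F := by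
  induction F using MvPolynomial.induction_on with
  | C c => simp [genericTranslate, algebraMap_eq]
  | add p q hp hq => simp only [map_add, hp, hq]
  | mul_X p q hp =>
    rw [map_mul, map_mul, hp, map_mul]
    simp [genericTranslate, Matrix.mul_apply, mul_comm]

theorem coeff_zero_genericTranslate (z : Matrix m n ℂ) (F : MvPolynomial (m × n) ℂ) :
    coeff 0 (genericTranslate z F) = coeff 0 F := by
  have h := eval_genericTranslate 0 z F
  have hg : (fun q : m × m => (0 : Matrix m m ℂ) q.1 q.2) = 0 := rfl
  have hz : (fun q : m × n => ((0 : Matrix m m ℂ) * z) q.1 q.2) = 0 := by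
    rw [Matrix.zero_mul]; rfl
  rwa [hg, hz, eval_zero, constantCoeff_eq, eval_zero, constantCoeff_eq] at h

theorem pderiv_genericTranslate [Fintype n] (z : Matrix m n ℂ) (i l : m)
    (F : MvPolynomial (m × n) ℂ) :
    pderiv (i, l) (genericTranslate z F) =
      ∑ c, z l c • genericTranslate z (pderiv (i, c) F) := by
  classical
  induction F using MvPolynomial.induction_on with
  | C c => simp [genericTranslate, algebraMap_eq]
  | add p q hp hq => simp only [map_add, hp, hq, smul_add, Finset.sum_add_distrib]
  | mul_X p q hp =>
    obtain ⟨r, d⟩ := q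
    have hX : pderiv (i, l) (genericTranslate z (X (r, d))) =
        if r = i then C (z l d) else 0 := by
      simp only [genericTranslate, aeval_X, map_sum, Derivation.leibniz, pderiv_C, pderiv_X,
        smul_zero, add_zero]
      split_ifs with h
      · subst h
        simp [Pi.single_apply]
      · simp [h]
    have hX' : ∀ c, genericTranslate z (pderiv (i, c) (X (r, d))) =
        if r = i then (if d = c then 1 else 0) else 0 := by
      intro c
      rw [pderiv_X, Pi.single_apply]
      split_ifs <;> simp_all
    simp only [map_mul, Derivation.leibniz, hp, hX, map_add, smul_eq_mul, hX', smul_add,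
      Finset.sum_add_distrib, Finset.mul_sum, mul_smul_comm]
    congr 1
    split_ifs
    · simp [smul_eq_C_mul, mul_comm]
    · simp

/-- Pairing against a product of variables in prescribed rows differentiates `F` along those rows,
uniformly in the columns `s` chosen for the variables. -/
theorem exists_fischerPairing_prod_X_mul [Fintype n] (k : ℕ) (r : Fin k → m)
    (F : MvPolynomial (m × n) ℂ) :
    ∃ G : (Fin k → n) → MvPolynomial (m × n) ℂ,
      ∀ (z : Matrix m n ℂ) (s : Fin k → m) (p : MvPolynomial (m × m) ℂ),
        fischerPairing ((∏ j, X (r j, s j)) * p) (genericTranslate z F) =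
          ∑ c, (∏ j, z (s j) (c j)) * fischerPairing p (genericTranslate z (G c)) := by
  induction k generalizing F with
  | zero => exact ⟨fun _ => F, fun z s p => by simp⟩
  | succ k ih =>
    choose G hG using fun c₀ => ih (fun j => r j.succ) (pderiv (r 0, c₀) F)
    refine ⟨fun c => G (c 0) (fun j => c j.succ), fun z s p => ?_⟩
    rw [Fin.prod_univ_succ, mul_assoc, fischerPairing_X_mul, pderiv_genericTranslate, map_sum,
      ← (Fin.consEquiv fun _ => n).sum_comp, Fintype.sum_prod_type]
    refine Finset.sum_congr rfl fun c₀ _ => ?_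
    rw [map_smul, hG c₀ z (fun j => s j.succ) p, smul_eq_mul, Finset.mul_sum]
    refine Finset.sum_congr rfl fun c _ => ?_
    simp [Fin.consEquiv, Fin.prod_univ_succ, mul_assoc]

end GenericTranslate

section Plucker

variable {a b : ℕ}

/-- The algebra generated by the Plücker coordinates. -/
noncomputable abbrev pluckerAlgebra (a b : ℕ) : Subalgebra ℂ (MvPolynomial (Fin a × Fin b) ℂ) :=
  Algebra.adjoin ℂ
    { p : MvPolynomial (Fin a × Fin b) ℂ |
      ∃ (J : Finset (Fin b)) (h : J.card = a), p = plucker J h }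

theorem det_columns_mem_pluckerAlgebra (c : Fin a → Fin b) :
    ((mvPolynomialX (Fin a) (Fin b) ℂ).submatrix id c).det ∈ pluckerAlgebra a b := by
  by_cases hc : Function.Injective c
  · set J : Finset (Fin b) := Finset.univ.image c with hJ
    have hcard : J.card = a := by
      rw [hJ, Finset.card_image_of_injective _ hc, Finset.card_univ, Fintype.card_fin]
    have hmem : ∀ i, c i ∈ J := fun i => Finset.mem_image_of_mem c (Finset.mem_univ i)
    let e : Fin a → Fin a := fun i => (J.orderIsoOfFin hcard).symm ⟨c i, hmem i⟩
    have he : ∀ i, J.orderEmbOfFin hcard (e i) = c i := fun i => by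
      rw [← Finset.coe_orderIsoOfFin_apply]
      simp [e]
    have hinj : Function.Injective e := fun i j h => hc (by rw [← he i, ← he j, h])
    let τ : Equiv.Perm (Fin a) := Equiv.ofBijective e (Finite.injective_iff_bijective.mp hinj)
    have hsub : (mvPolynomialX (Fin a) (Fin b) ℂ).submatrix id c =
        (Matrix.of fun r c : Fin a => X (r, J.orderEmbOfFin hcard c)).submatrix id τ := by
      ext i j : 1
      simp [τ, he]
    rw [hsub, Matrix.det_permute']
    exact mul_mem (intCast_mem _ _) (Algebra.subset_adjoin ⟨J, hcard, rfl⟩)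
  · obtain ⟨i, j, hij, hne⟩ := Function.not_injective_iff.mp hc
    rw [Matrix.det_zero_of_column_eq hne fun k => by simp [hij]]
    exact zero_mem _

theorem exists_fischerPairing_det_mul (F : MvPolynomial (Fin a × Fin b) ℂ) :
    ∃ G : (Fin a → Fin b) → MvPolynomial (Fin a × Fin b) ℂ,
      ∀ (z : Matrix (Fin a) (Fin b) ℂ) (p : MvPolynomial (Fin a × Fin a) ℂ),
        fischerPairing ((mvPolynomialX (Fin a) (Fin a) ℂ).det * p) (genericTranslate z F) =
          ∑ c, (z.submatrix id c).det * fischerPairing p (genericTranslate z (G c)) := by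
  obtain ⟨G, hG⟩ := exists_fischerPairing_prod_X_mul a id F
  refine ⟨G, fun z p => ?_⟩
  rw [← Matrix.det_transpose, Matrix.det_apply']
  simp only [Finset.sum_mul, map_sum, LinearMap.sum_apply, Matrix.det_apply']
  rw [Finset.sum_comm]
  refine Finset.sum_congr rfl fun τ _ => ?_
  have := hG z τ p
  simp only [id] at this
  simp only [Matrix.transpose_apply, Matrix.mvPolynomialX_apply, Matrix.submatrix_apply, id]
  rw [mul_assoc, ← zsmul_eq_mul, map_zsmul, LinearMap.smul_apply, this,
    Finset.smul_sum]
  simp [mul_assoc]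

theorem exists_mem_pluckerAlgebra_eval_eq_fischerPairing (k : ℕ)
    (F : MvPolynomial (Fin a × Fin b) ℂ) :
    ∃ P ∈ pluckerAlgebra a b, ∀ z : Matrix (Fin a) (Fin b) ℂ,
      eval (fun q => z q.1 q.2) P =
        fischerPairing ((mvPolynomialX (Fin a) (Fin a) ℂ).det ^ k) (genericTranslate z F) := by
  induction k generalizing F with
  | zero =>
    refine ⟨algebraMap ℂ _ (coeff 0 F), Subalgebra.algebraMap_mem _ _, fun z => ?_⟩
    simp [fischerPairing_one, coeff_zero_genericTranslate, algebraMap_eq]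
  | succ k ih =>
    obtain ⟨G, hG⟩ := exists_fischerPairing_det_mul F
    choose P hP hPeval using fun c => ih (G c)
    refine ⟨∑ c, ((mvPolynomialX (Fin a) (Fin b) ℂ).submatrix id c).det * P c,
      sum_mem fun c _ => mul_mem (det_columns_mem_pluckerAlgebra c) (hP c), fun z => ?_⟩
    rw [pow_succ', hG, map_sum]
    refine Finset.sum_congr rfl fun c _ => ?_
    rw [map_mul, hPeval, RingHom.map_det]
    congr 2
    ext i j : 1
    simp

end Plucker

section Invariant

variable {m n : Type*} [DecidableEq m]

/-- The polynomial `t ↦ f (diag(t at i₀, 1 elsewhere) * z)`. -/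
noncomputable def rowScaling (i₀ : m) (z : Matrix m n ℂ) (f : MvPolynomial (m × n) ℂ) :
    Polynomial ℂ :=
  aeval (fun q => (if q.1 = i₀ then Polynomial.X else 1) * Polynomial.C (z q.1 q.2)) f

theorem natDegree_rowScaling_le (i₀ : m) (z : Matrix m n ℂ) (f : MvPolynomial (m × n) ℂ) :
    (rowScaling i₀ z f).natDegree ≤ f.totalDegree := by
  rw [← mul_one f.totalDegree]
  refine aeval_natDegree_le f le_rfl _ fun q => ?_
  refine (Polynomial.natDegree_mul_C_le _ _).trans ?_
  split_ifs <;> simp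

variable [Fintype m]

theorem eval_rowScaling (i₀ : m) (z : Matrix m n ℂ) (f : MvPolynomial (m × n) ℂ) (t : ℂ) :
    (rowScaling i₀ z f).eval t =
      eval (fun q => (Matrix.diagonal (Function.update 1 i₀ t) * z) q.1 q.2) f := by
  induction f using MvPolynomial.induction_on with
  | C c => simp [rowScaling]
  | add p q hp hq => simp_all [rowScaling]
  | mul_X p q hp =>
    rw [map_mul, ← hp]
    simp only [rowScaling, map_mul, aeval_X, Polynomial.eval_mul, Polynomial.eval_C, eval_X,
      Matrix.diagonal_mul, Function.update_apply]
    split_ifs <;> simp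

/-- Invariance under determinant one matrices forces `f (g * z)` to be a polynomial in `det g`. -/
theorem genericTranslate_eq_aeval_det {f : MvPolynomial (m × n) ℂ}
    (hf : ∀ g : Matrix m m ℂ, g.det = 1 → ∀ z : Matrix m n ℂ,
      eval (fun q => (g * z) q.1 q.2) f = eval (fun q => z q.1 q.2) f)
    (i₀ : m) (z : Matrix m n ℂ) :
    genericTranslate z f = Polynomial.aeval (mvPolynomialX m m ℂ).det (rowScaling i₀ z f) := by
  refine eq_of_eval_eq_on_gl fun u => ?_
  have h : IsUnit (u : Matrix m m ℂ).det := (Matrix.isUnit_iff_isUnit_det _).mp u.isUnit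
  generalize (u : Matrix m m ℂ) = g at h ⊢
  have hdet : eval (fun q => g q.1 q.2) (mvPolynomialX m m ℂ).det = g.det :=
    Matrix.eval_det_mvPolynomialX m ℂ _
  have hright : eval (fun q => g q.1 q.2) (Polynomial.aeval (mvPolynomialX m m ℂ).det (rowScaling i₀ z f)) =
      (rowScaling i₀ z f).eval g.det := by
    have hC : (eval fun q : m × m => g q.1 q.2).comp C = RingHom.id ℂ :=
      RingHom.ext fun c => eval_C c
    rw [Polynomial.aeval_def, Polynomial.hom_eval₂, hdet, algebraMap_eq, hC, Polynomial.eval₂_id]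
  rw [hright, eval_rowScaling, eval_genericTranslate]
  set D : Matrix m m ℂ := Matrix.diagonal (Function.update 1 i₀ g.det)
  have hD : D.det = g.det := by
    rw [Matrix.det_diagonal, Finset.prod_update_of_mem (Finset.mem_univ _)]
    simp
  have hunit : IsUnit D.det := by rw [hD]; exact h
  rw [← hf (g * D⁻¹) (by
    rw [Matrix.det_mul, Matrix.det_nonsing_inv, hD, Ring.mul_inverse_cancel _ h]) (D * z),
    Matrix.mul_assoc, Matrix.nonsing_inv_mul_cancel_left _ _ hunit]

end Invariant

/-- First Fundamental Theorem of invariant theory (Theorem 6.7.3): every polynomial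
in the entries of an `a × b` matrix that is invariant under left multiplication by
`SL_a(ℂ)` lies in the `ℂ`-subalgebra generated by the Plücker coordinates `P_J`. -/
theorem first_fundamental_theorem (a b : ℕ) (ha : 1 ≤ a) (hab : a ≤ b)
    (f : MvPolynomial (Fin a × Fin b) ℂ)
    (hf : ∀ g : Matrix (Fin a) (Fin a) ℂ, g.det = 1 →
      ∀ z : Matrix (Fin a) (Fin b) ℂ,
        eval (fun q => (g * z) q.1 q.2) f = eval (fun q => z q.1 q.2) f) :
    f ∈ Algebra.adjoin ℂ
      { p : MvPolynomial (Fin a × Fin b) ℂ |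
        ∃ (J : Finset (Fin b)) (h : J.card = a), p = plucker J h } := by
  have i₀ : Fin a := ⟨0, ha⟩
  have : Nonempty (Fin a) := ⟨i₀⟩
  set d := (mvPolynomialX (Fin a) (Fin a) ℂ).det
  choose P hP hPeval using fun k => exists_mem_pluckerAlgebra_eval_eq_fischerPairing k f
  have hcoeff : ∀ z k, (rowScaling i₀ z f).coeff k =
      (fischerPairing (d ^ k) (d ^ k))⁻¹ * eval (fun q => z q.1 q.2) (P k) := by
    intro z k
    rw [eq_inv_mul_iff_mul_eq₀ (fischerPairing_det_pow_self_ne_zero _ k), hPeval,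
      genericTranslate_eq_aeval_det hf i₀, Polynomial.aeval_eq_sum_range, map_sum,
      Finset.sum_eq_single k]
    · rw [map_smul, smul_eq_mul, mul_comm]
    · intro j _ hj
      rw [map_smul, fischerPairing_det_pow_of_ne hj.symm, smul_zero]
    · intro hk
      rw [Polynomial.coeff_eq_zero_of_natDegree_lt (by simpa using hk), zero_smul, map_zero]
  have hfsum : f = ∑ k ∈ Finset.range (f.totalDegree + 1),
      (fischerPairing (d ^ k) (d ^ k))⁻¹ • P k := by
    refine MvPolynomial.funext fun x => ?_
    have h := eval_rowScaling i₀ (Matrix.of fun i j => x (i, j)) f 1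
    rw [Polynomial.eval_eq_sum_range'
      (Nat.lt_succ_of_le (natDegree_rowScaling_le i₀ _ f))] at h
    simp only [hcoeff, one_pow, mul_one] at h
    have hone : Function.update (1 : Fin a → ℂ) i₀ 1 = 1 := Function.update_eq_self i₀ 1
    rw [hone, Matrix.diagonal_one', Matrix.one_mul] at h
    rw [map_sum]
    simpa [smul_eval] using h.symm
  rw [hfsum]
  exact sum_mem fun k _ => Subalgebra.smul_mem _ (hP k) _
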